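/- Let n ≥ 1 and for each 1 ≤ k ≤ n let π_k be a policy mapping beliefs to actions in U such that π_k(b) ∈ argmax_{u∈U} Q_k(b,u) for every belief b. Define the executed expected total rewards under the true strategy by J_0(b) = 0 and, for 1 ≤ k ≤ n, J_k(b) = Σ_{s,v} b(s) Pr*(s,v) R(s, π_k(b), v) + φ Σ_{v,o} Pr_{Pr*}(v,o|b,π_k(b)) · J_{k−1}(B_{Pr*}(b, π_k(b), v, o)) (summands with Pr_{Pr*}(v,o|b,π_k(b)) = 0 taken to be 0). Then the performance loss satisfies sup_b |V*_n(b) − J_n(b)| ≤ 2 ε_p |V| R_max [ φ^(n−1) + (1/(1−φ)) (1 + 3φ|O|/(1−φ)) ]. -/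

import Mathlib

open Finset

noncomputable section

variable {S U V O : Type*}

/-- `b : S → ℝ` is a belief (probability distribution over states). -/
def IsBelief [Fintype S] (b : S → ℝ) : Prop :=
  (∀ s, 0 ≤ b s) ∧ ∑ s, b s = 1

/-- `P : S → V → ℝ` is a (mixed) strategy of the other agent. -/
def IsStrategy [Fintype V] (P : S → V → ℝ) : Prop :=
  (∀ s v, 0 ≤ P s v) ∧ ∀ s, ∑ v, P s v = 1

/-- Expected immediate payoff `R_P(b,u) = Σ_{s,v} b(s) P(s,v) R(s,u,v)`. -/
def expR [Fintype S] [Fintype V] (R : S → U → V → ℝ) (P : S → V → ℝ)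
    (b : S → ℝ) (u : U) : ℝ :=
  ∑ s, ∑ v, b s * P s v * R s u v

/-- Belief-state observation model
`Pr_P(v,o|b,u) = Σ_{s'} Z(s',u,o) Σ_s T(s,u,v,s') P(s,v) b(s)`. -/
def obsPr [Fintype S] (T : S → U → V → S → ℝ) (Z : S → U → O → ℝ)
    (P : S → V → ℝ) (b : S → ℝ) (u : U) (v : V) (o : O) : ℝ :=
  ∑ s', Z s' u o * ∑ s, T s u v s' * P s v * b s

/-- Unnormalized belief update
`F_P(b,u,v,o)(s') = Z(s',u,o) Σ_s T(s,u,v,s') P(s,v) b(s)`. -/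
def unnormUpd [Fintype S] (T : S → U → V → S → ℝ) (Z : S → U → O → ℝ)
    (P : S → V → ℝ) (b : S → ℝ) (u : U) (v : V) (o : O) (s' : S) : ℝ :=
  Z s' u o * ∑ s, T s u v s' * P s v * b s

/-- Normalized belief update `B_P(b,u,v,o)`. -/
def beliefUpd [Fintype S] (T : S → U → V → S → ℝ) (Z : S → U → O → ℝ)
    (P : S → V → ℝ) (b : S → ℝ) (u : U) (v : V) (o : O) (s' : S) : ℝ :=
  unnormUpd T Z P b u v o s' / obsPr T Z P b u v o

/-- Value function of I-POMDP Lite: `V^P_0(b) = 0` and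
`V^P_{n+1}(b) = max_u [ R_P(b,u) + φ Σ_{v,o} Pr_P(v,o|b,u) V^P_n(B_P(b,u,v,o)) ]`
(summands with `Pr_P(v,o|b,u) = 0` vanish since they are multiplied by `0`). -/
def valFun [Fintype S] [Fintype U] [Fintype V] [Fintype O] [Nonempty U]
    (T : S → U → V → S → ℝ) (Z : S → U → O → ℝ) (R : S → U → V → ℝ)
    (P : S → V → ℝ) (φ : ℝ) : ℕ → (S → ℝ) → ℝ
  | 0, _ => 0
  | n + 1, b => ⨆ u : U, (expR R P b u +
      φ * ∑ v, ∑ o, obsPr T Z P b u v o * valFun T Z R P φ n (beliefUpd T Z P b u v o))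

/-- Q-function of I-POMDP Lite: `qFun … n` is `Q^P_{n+1}`, i.e.
`Q^P_{n+1}(b,u) = R_P(b,u) + φ Σ_{v,o} Pr_P(v,o|b,u) V^P_n(B_P(b,u,v,o))`,
so that `V^P_{n+1}(b) = max_u (qFun … n b u)`. -/
def qFun [Fintype S] [Fintype U] [Fintype V] [Fintype O] [Nonempty U]
    (T : S → U → V → S → ℝ) (Z : S → U → O → ℝ) (R : S → U → V → ℝ)
    (P : S → V → ℝ) (φ : ℝ) (n : ℕ) (b : S → ℝ) (u : U) : ℝ :=
  expR R P b u +
    φ * ∑ v, ∑ o, obsPr T Z P b u v o * valFun T Z R P φ n (beliefUpd T Z P b u v o)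

/-- Prediction error `ε_p = max_{s,v} |Pr*(s,v) − Pr(s,v)|`. -/
def predErr [Fintype S] [Fintype V] [Nonempty S] [Nonempty V]
    (Pstar Ppred : S → V → ℝ) : ℝ :=
  ⨆ s : S, ⨆ v : V, |Pstar s v - Ppred s v|

/-- Expected total reward of executing the (greedy) policy `π` under the true
strategy `Pstar`: `J_0(b) = 0` and
`J_{k+1}(b) = R_{P*}(b,π_{k+1}(b)) + φ Σ_{v,o} Pr_{P*}(v,o|b,π_{k+1}(b)) J_k(B_{P*}(b,π_{k+1}(b),v,o))`. -/
def execJ [Fintype S] [Fintype V] [Fintype O]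
    (T : S → U → V → S → ℝ) (Z : S → U → O → ℝ) (R : S → U → V → ℝ)
    (Pstar : S → V → ℝ) (φ : ℝ) (π : ℕ → (S → ℝ) → U) : ℕ → (S → ℝ) → ℝ
  | 0, _ => 0
  | k + 1, b =>
      expR R Pstar b (π (k + 1) b) +
        φ * ∑ v, ∑ o, obsPr T Z Pstar b (π (k + 1) b) v o *
          execJ T Z R Pstar φ π k (beliefUpd T Z Pstar b (π (k + 1) b) v o)

/-- The supremum over a finite nonempty type is 1-Lipschitz for the uniform distance. -/
lemma abs_ciSup_sub_ciSup_le {ι : Type*} [Finite ι] [Nonempty ι] {f g : ι → ℝ} {C : ℝ}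
    (h : ∀ i, |f i - g i| ≤ C) : |(⨆ i, f i) - ⨆ i, g i| ≤ C := by
  rw [abs_le]
  constructor
  · have : (⨆ i, g i) ≤ (⨆ i, f i) + C := ciSup_le fun i => by
      have h1 := le_ciSup (Set.finite_range f).bddAbove i
      have h2 := (abs_le.mp (h i)).1
      linarith
    linarith
  · have : (⨆ i, f i) ≤ (⨆ i, g i) + C := ciSup_le fun i => by
      have h1 := le_ciSup (Set.finite_range g).bddAbove i
      have h2 := (abs_le.mp (h i)).2
      linarith
    linarith

/-- The unnormalized observation update preserves the total mass of a joint weight on states and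
opponent actions. -/
lemma sum_observation_mass [Fintype S] [Fintype V] [Fintype O]
    {T : S → U → V → S → ℝ} {Z : S → U → O → ℝ}
    (hT1 : ∀ s u v, ∑ s', T s u v s' = 1) (hZ1 : ∀ s' u, ∑ o, Z s' u o = 1)
    (w : S → V → ℝ) (u : U) :
    ∑ v, ∑ o, ∑ s', Z s' u o * ∑ s, T s u v s' * w s v = ∑ s, ∑ v, w s v := by
  rw [Finset.sum_comm (s := (univ : Finset S)) (t := (univ : Finset V))]
  refine Finset.sum_congr rfl fun v _ => ?_
  rw [Finset.sum_comm]
  simp_rw [← Finset.sum_mul, hZ1, one_mul]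
  rw [Finset.sum_comm]
  simp_rw [← Finset.sum_mul, hT1, one_mul]

/-- The unnormalized observation update does not increase the `ℓ¹` norm. -/
lemma sum_abs_observation_mass_le [Fintype S] [Fintype V] [Fintype O]
    {T : S → U → V → S → ℝ} {Z : S → U → O → ℝ}
    (hT0 : ∀ s u v s', 0 ≤ T s u v s') (hT1 : ∀ s u v, ∑ s', T s u v s' = 1)
    (hZ0 : ∀ s' u o, 0 ≤ Z s' u o) (hZ1 : ∀ s' u, ∑ o, Z s' u o = 1)
    (w : S → V → ℝ) (u : U) :
    ∑ v, ∑ o, ∑ s', |Z s' u o * ∑ s, T s u v s' * w s v| ≤ ∑ s, ∑ v, |w s v| := by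
  rw [← sum_observation_mass hT1 hZ1 (fun s v => |w s v|) u]
  refine Finset.sum_le_sum fun v _ => Finset.sum_le_sum fun o _ => Finset.sum_le_sum fun s' _ => ?_
  rw [abs_mul, abs_of_nonneg (hZ0 s' u o)]
  refine mul_le_mul_of_nonneg_left ((Finset.abs_sum_le_sum_abs _ _).trans_eq ?_) (hZ0 s' u o)
  exact Finset.sum_congr rfl fun s _ => by rw [abs_mul, abs_of_nonneg (hT0 s u v s')]

lemma unnormUpd_nonneg [Fintype S] {T : S → U → V → S → ℝ} {Z : S → U → O → ℝ}
    (hT0 : ∀ s u v s', 0 ≤ T s u v s') (hZ0 : ∀ s' u o, 0 ≤ Z s' u o)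
    {P : S → V → ℝ} (hP0 : ∀ s v, 0 ≤ P s v) {b : S → ℝ} (hb : ∀ s, 0 ≤ b s)
    (u : U) (v : V) (o : O) (s' : S) : 0 ≤ unnormUpd T Z P b u v o s' :=
  mul_nonneg (hZ0 _ _ _) (Finset.sum_nonneg fun _ _ =>
    mul_nonneg (mul_nonneg (hT0 _ _ _ _) (hP0 _ _)) (hb _))

lemma obsPr_nonneg [Fintype S] {T : S → U → V → S → ℝ} {Z : S → U → O → ℝ}
    (hT0 : ∀ s u v s', 0 ≤ T s u v s') (hZ0 : ∀ s' u o, 0 ≤ Z s' u o)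
    {P : S → V → ℝ} (hP0 : ∀ s v, 0 ≤ P s v) {b : S → ℝ} (hb : ∀ s, 0 ≤ b s)
    (u : U) (v : V) (o : O) : 0 ≤ obsPr T Z P b u v o :=
  Finset.sum_nonneg fun s' _ => unnormUpd_nonneg hT0 hZ0 hP0 hb u v o s'

lemma obsPr_mul_beliefUpd [Fintype S] {T : S → U → V → S → ℝ} {Z : S → U → O → ℝ}
    (hT0 : ∀ s u v s', 0 ≤ T s u v s') (hZ0 : ∀ s' u o, 0 ≤ Z s' u o)
    {P : S → V → ℝ} (hP0 : ∀ s v, 0 ≤ P s v) {b : S → ℝ} (hb : ∀ s, 0 ≤ b s)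
    (u : U) (v : V) (o : O) (s' : S) :
    obsPr T Z P b u v o * beliefUpd T Z P b u v o s' = unnormUpd T Z P b u v o s' := by
  unfold beliefUpd
  by_cases h : obsPr T Z P b u v o = 0
  · have h0 : ∑ s', unnormUpd T Z P b u v o s' = 0 := h
    rw [Finset.sum_eq_zero_iff_of_nonneg
      (fun s' _ => unnormUpd_nonneg hT0 hZ0 hP0 hb u v o s')] at h0
    rw [h, h0 s' (Finset.mem_univ _), zero_mul]
  · exact mul_div_cancel₀ _ h

lemma isBelief_beliefUpd [Fintype S] {T : S → U → V → S → ℝ} {Z : S → U → O → ℝ}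
    (hT0 : ∀ s u v s', 0 ≤ T s u v s') (hZ0 : ∀ s' u o, 0 ≤ Z s' u o)
    {P : S → V → ℝ} (hP0 : ∀ s v, 0 ≤ P s v) {b : S → ℝ} (hb : ∀ s, 0 ≤ b s)
    {u : U} {v : V} {o : O} (h : obsPr T Z P b u v o ≠ 0) :
    IsBelief (beliefUpd T Z P b u v o) := by
  refine ⟨fun s' => div_nonneg (unnormUpd_nonneg hT0 hZ0 hP0 hb u v o s')
    (obsPr_nonneg hT0 hZ0 hP0 hb u v o), ?_⟩
  unfold beliefUpd
  rw [← Finset.sum_div]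
  exact div_self h

lemma sum_obsPr [Fintype S] [Fintype V] [Fintype O]
    {T : S → U → V → S → ℝ} {Z : S → U → O → ℝ}
    (hT1 : ∀ s u v, ∑ s', T s u v s' = 1) (hZ1 : ∀ s' u, ∑ o, Z s' u o = 1)
    {P : S → V → ℝ} (hP : IsStrategy P) {b : S → ℝ} (hb : IsBelief b) (u : U) :
    ∑ v, ∑ o, obsPr T Z P b u v o = 1 := by
  have h := sum_observation_mass hT1 hZ1 (fun s v => P s v * b s) u
  simp_rw [← Finset.sum_mul, hP.2, one_mul, hb.2, ← mul_assoc] at h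
  exact h

/-- The expected continuation value depends 1-Lipschitz on the value function. -/
lemma abs_sum_obsPr_mul_sub_le [Fintype S] [Fintype V] [Fintype O]
    {T : S → U → V → S → ℝ} {Z : S → U → O → ℝ}
    (hT0 : ∀ s u v s', 0 ≤ T s u v s') (hT1 : ∀ s u v, ∑ s', T s u v s' = 1)
    (hZ0 : ∀ s' u o, 0 ≤ Z s' u o) (hZ1 : ∀ s' u, ∑ o, Z s' u o = 1)
    {P : S → V → ℝ} (hP : IsStrategy P) {g h : (S → ℝ) → ℝ} {E : ℝ}
    (hgh : ∀ b, IsBelief b → |g b - h b| ≤ E) {b : S → ℝ} (hb : IsBelief b) (u : U) :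
    |∑ v, ∑ o, obsPr T Z P b u v o * g (beliefUpd T Z P b u v o) -
      ∑ v, ∑ o, obsPr T Z P b u v o * h (beliefUpd T Z P b u v o)| ≤ E := by
  simp_rw [← Finset.sum_sub_distrib]
  calc _ ≤ ∑ v, ∑ o, obsPr T Z P b u v o * E := by
        refine (Finset.abs_sum_le_sum_abs _ _).trans (Finset.sum_le_sum fun v _ => ?_)
        refine (Finset.abs_sum_le_sum_abs _ _).trans (Finset.sum_le_sum fun o _ => ?_)
        have h0 := obsPr_nonneg hT0 hZ0 hP.1 hb.1 u v o
        rw [← mul_sub, abs_mul, abs_of_nonneg h0]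
        by_cases hz : obsPr T Z P b u v o = 0
        · simp [hz]
        · exact mul_le_mul_of_nonneg_left
            (hgh _ (isBelief_beliefUpd hT0 hZ0 hP.1 hb.1 hz)) h0
    _ = E := by
        simp_rw [← Finset.sum_mul]
        rw [sum_obsPr hT1 hZ1 hP hb, one_mul]

/-- The value functions are positively homogeneous. -/
lemma valFun_smul [Fintype S] [Fintype U] [Fintype V] [Fintype O] [Nonempty U]
    (T : S → U → V → S → ℝ) (Z : S → U → O → ℝ) (R : S → U → V → ℝ)
    (P : S → V → ℝ) (φ : ℝ) (k : ℕ) {c : ℝ} (hc : 0 ≤ c) (b : S → ℝ) :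
    valFun T Z R P φ k (fun s => c * b s) = c * valFun T Z R P φ k b := by
  cases k with
  | zero => simp [valFun]
  | succ k =>
    have hR : ∀ u, expR R P (fun s => c * b s) u = c * expR R P b u := fun u => by
      simp only [expR, Finset.mul_sum, mul_assoc]
    have hF : ∀ u v o s', unnormUpd T Z P (fun s => c * b s) u v o s' =
        c * unnormUpd T Z P b u v o s' := fun u v o s' => by
      simp only [unnormUpd, Finset.mul_sum]
      exact Finset.sum_congr rfl fun s _ => by ring
    have hO : ∀ u v o, obsPr T Z P (fun s => c * b s) u v o = c * obsPr T Z P b u v o :=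
      fun u v o => by
        change ∑ s', unnormUpd T Z P _ u v o s' = c * ∑ s', unnormUpd T Z P b u v o s'
        simp_rw [hF, Finset.mul_sum]
    simp only [valFun]
    rw [Real.mul_iSup_of_nonneg hc]
    refine iSup_congr fun u => ?_
    rw [hR, mul_add]
    congr 1
    rw [mul_left_comm]
    simp_rw [Finset.mul_sum]
    refine Finset.sum_congr rfl fun v _ => Finset.sum_congr rfl fun o _ => ?_
    rw [hO]
    rcases hc.eq_or_lt with rfl | hpos
    · simp
    · have hB : beliefUpd T Z P (fun s => c * b s) u v o = beliefUpd T Z P b u v o := by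
        funext s'
        simp only [beliefUpd, hF, hO]
        exact mul_div_mul_left _ _ hpos.ne'
      rw [hB, mul_assoc]

lemma obsPr_mul_valFun_beliefUpd [Fintype S] [Fintype U] [Fintype V] [Fintype O] [Nonempty U]
    {T : S → U → V → S → ℝ} {Z : S → U → O → ℝ}
    (hT0 : ∀ s u v s', 0 ≤ T s u v s') (hZ0 : ∀ s' u o, 0 ≤ Z s' u o)
    (R : S → U → V → ℝ) (P' : S → V → ℝ) (φ : ℝ) (k : ℕ)
    {P : S → V → ℝ} (hP0 : ∀ s v, 0 ≤ P s v) {b : S → ℝ} (hb : ∀ s, 0 ≤ b s)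
    (u : U) (v : V) (o : O) :
    obsPr T Z P b u v o * valFun T Z R P' φ k (beliefUpd T Z P b u v o) =
      valFun T Z R P' φ k (unnormUpd T Z P b u v o) := by
  rw [← valFun_smul T Z R P' φ k (obsPr_nonneg hT0 hZ0 hP0 hb u v o)]
  congr 1
  funext s'
  exact obsPr_mul_beliefUpd hT0 hZ0 hP0 hb u v o s'

/-- One Bellman backup of an `L`-Lipschitz value function is Lipschitz, with constant
`Rmax + φ * L`, in the joint weight on states and opponent actions. -/
lemma abs_backup_sub_backup_le [Fintype S] [Fintype U] [Fintype V] [Fintype O] [Nonempty U]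
    {T : S → U → V → S → ℝ} {Z : S → U → O → ℝ} {R : S → U → V → ℝ} {φ Rmax L : ℝ}
    (hT0 : ∀ s u v s', 0 ≤ T s u v s') (hT1 : ∀ s u v, ∑ s', T s u v s' = 1)
    (hZ0 : ∀ s' u o, 0 ≤ Z s' u o) (hZ1 : ∀ s' u, ∑ o, Z s' u o = 1)
    (hR : ∀ s u v, 0 ≤ R s u v ∧ R s u v ≤ Rmax) (hφ0 : 0 < φ) (hL : 0 ≤ L)
    (Q : S → V → ℝ) (k : ℕ)
    (hLip : ∀ f g : S → ℝ, (∀ s, 0 ≤ f s) → (∀ s, 0 ≤ g s) →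
      |valFun T Z R Q φ k f - valFun T Z R Q φ k g| ≤ L * ∑ s, |f s - g s|)
    {P₁ P₂ : S → V → ℝ} (hP₁ : ∀ s v, 0 ≤ P₁ s v) (hP₂ : ∀ s v, 0 ≤ P₂ s v)
    {b₁ b₂ : S → ℝ} (hb₁ : ∀ s, 0 ≤ b₁ s) (hb₂ : ∀ s, 0 ≤ b₂ s) (u : U) :
    |(expR R P₁ b₁ u + φ * ∑ v, ∑ o, obsPr T Z P₁ b₁ u v o *
        valFun T Z R Q φ k (beliefUpd T Z P₁ b₁ u v o)) -
      (expR R P₂ b₂ u + φ * ∑ v, ∑ o, obsPr T Z P₂ b₂ u v o *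
        valFun T Z R Q φ k (beliefUpd T Z P₂ b₂ u v o))| ≤
      (Rmax + φ * L) * ∑ s, ∑ v, |P₁ s v * b₁ s - P₂ s v * b₂ s| := by
  have hrew : |expR R P₁ b₁ u - expR R P₂ b₂ u| ≤
      Rmax * ∑ s, ∑ v, |P₁ s v * b₁ s - P₂ s v * b₂ s| := by
    simp only [expR, ← Finset.sum_sub_distrib, Finset.mul_sum]
    refine (Finset.abs_sum_le_sum_abs _ _).trans (Finset.sum_le_sum fun s _ => ?_)
    refine (Finset.abs_sum_le_sum_abs _ _).trans (Finset.sum_le_sum fun v _ => ?_)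
    have : b₁ s * P₁ s v * R s u v - b₂ s * P₂ s v * R s u v =
        R s u v * (P₁ s v * b₁ s - P₂ s v * b₂ s) := by ring
    rw [this, abs_mul, abs_of_nonneg (hR s u v).1]
    exact mul_le_mul_of_nonneg_right (hR s u v).2 (abs_nonneg _)
  have hcont : |∑ v, ∑ o, valFun T Z R Q φ k (unnormUpd T Z P₁ b₁ u v o) -
      ∑ v, ∑ o, valFun T Z R Q φ k (unnormUpd T Z P₂ b₂ u v o)| ≤
      L * ∑ s, ∑ v, |P₁ s v * b₁ s - P₂ s v * b₂ s| := by
    refine le_trans ?_ (mul_le_mul_of_nonneg_left (sum_abs_observation_mass_le hT0 hT1 hZ0 hZ1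
      (fun s v => P₁ s v * b₁ s - P₂ s v * b₂ s) u) hL)
    rw [Finset.mul_sum]
    simp_rw [← Finset.sum_sub_distrib]
    refine (Finset.abs_sum_le_sum_abs _ _).trans (Finset.sum_le_sum fun v _ => ?_)
    rw [Finset.mul_sum]
    refine (Finset.abs_sum_le_sum_abs _ _).trans (Finset.sum_le_sum fun o _ => ?_)
    refine (hLip _ _ (unnormUpd_nonneg hT0 hZ0 hP₁ hb₁ u v o)
      (unnormUpd_nonneg hT0 hZ0 hP₂ hb₂ u v o)).trans_eq ?_
    congr 1
    refine Finset.sum_congr rfl fun s' _ => ?_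
    simp only [unnormUpd, mul_sub, Finset.sum_sub_distrib, mul_assoc]
  simp_rw [obsPr_mul_valFun_beliefUpd hT0 hZ0 R Q φ k hP₁ hb₁,
    obsPr_mul_valFun_beliefUpd hT0 hZ0 R Q φ k hP₂ hb₂]
  rw [add_sub_add_comm, ← mul_sub, add_mul, mul_assoc]
  refine (abs_add_le _ _).trans (add_le_add hrew ?_)
  rw [abs_mul, abs_of_pos hφ0]
  exact mul_le_mul_of_nonneg_left hcont hφ0.le

/-- The value functions are `Rmax / (1 - φ)`-Lipschitz for the `ℓ¹` norm. -/
lemma abs_valFun_sub_le [Fintype S] [Fintype U] [Fintype V] [Fintype O] [Nonempty U]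
    {T : S → U → V → S → ℝ} {Z : S → U → O → ℝ} {R : S → U → V → ℝ} {φ Rmax : ℝ}
    (hT0 : ∀ s u v s', 0 ≤ T s u v s') (hT1 : ∀ s u v, ∑ s', T s u v s' = 1)
    (hZ0 : ∀ s' u o, 0 ≤ Z s' u o) (hZ1 : ∀ s' u, ∑ o, Z s' u o = 1)
    (hR : ∀ s u v, 0 ≤ R s u v ∧ R s u v ≤ Rmax) (hRmax : 0 ≤ Rmax)
    (hφ0 : 0 < φ) (hφ1 : φ < 1) {P : S → V → ℝ} (hP : IsStrategy P) (k : ℕ)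
    {f g : S → ℝ} (hf : ∀ s, 0 ≤ f s) (hg : ∀ s, 0 ≤ g s) :
    |valFun T Z R P φ k f - valFun T Z R P φ k g| ≤ Rmax / (1 - φ) * ∑ s, |f s - g s| := by
  have h1 : 0 < 1 - φ := sub_pos.mpr hφ1
  have hL : 0 ≤ Rmax / (1 - φ) := div_nonneg hRmax h1.le
  induction k generalizing f g with
  | zero =>
    simp only [valFun, sub_self, abs_zero]
    exact mul_nonneg hL (Finset.sum_nonneg fun _ _ => abs_nonneg _)
  | succ k ih =>
    simp only [valFun]
    refine abs_ciSup_sub_ciSup_le fun u => ?_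
    refine (abs_backup_sub_backup_le hT0 hT1 hZ0 hZ1 hR hφ0 hL P k
      (fun f g hf hg => ih hf hg) hP.1 hP.1 hf hg u).trans_eq ?_
    congr 1
    · field_simp
      ring
    · refine Finset.sum_congr rfl fun s _ => ?_
      simp_rw [← mul_sub, abs_mul, abs_of_nonneg (hP.1 s _), ← Finset.sum_mul, hP.2, one_mul]

lemma abs_sub_le_predErr [Fintype S] [Fintype V] [Nonempty S] [Nonempty V]
    (P P' : S → V → ℝ) (s : S) (v : V) : |P s v - P' s v| ≤ predErr P P' :=
  (le_ciSup (f := fun v => |P s v - P' s v|) (Set.finite_range _).bddAbove v).trans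
    (le_ciSup (f := fun s => ⨆ v, |P s v - P' s v|) (Set.finite_range _).bddAbove s)

/-- Changing the strategy used in one backup of `valFun T Z R P φ k` from `Q` to `P` costs at most
`predErr Q P * |V| * Rmax / (1 - φ)`. -/
lemma abs_backup_sub_qFun_le [Fintype S] [Fintype U] [Fintype V] [Fintype O]
    [Nonempty S] [Nonempty U] [Nonempty V]
    {T : S → U → V → S → ℝ} {Z : S → U → O → ℝ} {R : S → U → V → ℝ} {φ Rmax : ℝ}
    (hT0 : ∀ s u v s', 0 ≤ T s u v s') (hT1 : ∀ s u v, ∑ s', T s u v s' = 1)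
    (hZ0 : ∀ s' u o, 0 ≤ Z s' u o) (hZ1 : ∀ s' u, ∑ o, Z s' u o = 1)
    (hR : ∀ s u v, 0 ≤ R s u v ∧ R s u v ≤ Rmax) (hRmax : 0 ≤ Rmax)
    (hφ0 : 0 < φ) (hφ1 : φ < 1) {Q P : S → V → ℝ} (hQ : IsStrategy Q) (hP : IsStrategy P)
    (k : ℕ) {b : S → ℝ} (hb : IsBelief b) (u : U) :
    |(expR R Q b u + φ * ∑ v, ∑ o, obsPr T Z Q b u v o *
        valFun T Z R P φ k (beliefUpd T Z Q b u v o)) - qFun T Z R P φ k b u| ≤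
      predErr Q P * Fintype.card V * Rmax / (1 - φ) := by
  have h1 : 0 < 1 - φ := sub_pos.mpr hφ1
  have hL : 0 ≤ Rmax / (1 - φ) := div_nonneg hRmax h1.le
  have hsum : ∑ s, ∑ v, |Q s v * b s - P s v * b s| ≤ predErr Q P * Fintype.card V := by
    calc _ ≤ ∑ s, ∑ _v : V, predErr Q P * b s := by
          refine Finset.sum_le_sum fun s _ => Finset.sum_le_sum fun v _ => ?_
          rw [← sub_mul, abs_mul, abs_of_nonneg (hb.1 s)]
          exact mul_le_mul_of_nonneg_right (abs_sub_le_predErr Q P s v) (hb.1 s)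
      _ = predErr Q P * Fintype.card V := by
          simp_rw [Finset.sum_const, Finset.card_univ, nsmul_eq_mul, ← Finset.mul_sum, hb.2]
          ring
  have h := abs_backup_sub_backup_le hT0 hT1 hZ0 hZ1 hR hφ0 hL P k
    (fun f g hf hg => abs_valFun_sub_le hT0 hT1 hZ0 hZ1 hR hRmax hφ0 hφ1 hP k hf hg)
    hQ.1 hP.1 hb.1 hb.1 u
  have hc : Rmax + φ * (Rmax / (1 - φ)) = Rmax / (1 - φ) := by
    field_simp
    ring
  rw [hc] at h
  refine h.trans ((mul_le_mul_of_nonneg_left hsum hL).trans_eq ?_)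
  ring

/-- Bellman recursion: a one-step error `δ` plus a discounted error `δ / (1 - φ)` in the
continuation values amounts to at most `δ / (1 - φ)`. -/
lemma abs_backup_sub_le_of_backup [Fintype S] [Fintype V] [Fintype O]
    {T : S → U → V → S → ℝ} {Z : S → U → O → ℝ} {R : S → U → V → ℝ} {φ : ℝ}
    (hT0 : ∀ s u v s', 0 ≤ T s u v s') (hT1 : ∀ s u v, ∑ s', T s u v s' = 1)
    (hZ0 : ∀ s' u o, 0 ≤ Z s' u o) (hZ1 : ∀ s' u, ∑ o, Z s' u o = 1)
    (hφ0 : 0 < φ) (hφ1 : φ < 1) {Q : S → V → ℝ} (hQ : IsStrategy Q)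
    {g h : (S → ℝ) → ℝ} {δ q : ℝ}
    (hgh : ∀ b, IsBelief b → |g b - h b| ≤ δ / (1 - φ)) {b : S → ℝ} (hb : IsBelief b) (u : U)
    (hq : |(expR R Q b u + φ * ∑ v, ∑ o, obsPr T Z Q b u v o *
        h (beliefUpd T Z Q b u v o)) - q| ≤ δ) :
    |(expR R Q b u + φ * ∑ v, ∑ o, obsPr T Z Q b u v o *
        g (beliefUpd T Z Q b u v o)) - q| ≤ δ / (1 - φ) := by
  have h1 : 1 - φ ≠ 0 := (sub_pos.mpr hφ1).ne'
  have hc := mul_le_mul_of_nonneg_left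
    (abs_sum_obsPr_mul_sub_le hT0 hT1 hZ0 hZ1 hQ hgh hb u) hφ0.le
  rw [← abs_of_pos hφ0, ← abs_mul, abs_of_pos hφ0, mul_sub] at hc
  have hd : δ / (1 - φ) = δ + φ * (δ / (1 - φ)) := by
    field_simp
    ring
  rw [hd]
  rw [abs_le] at hc hq ⊢
  constructor <;> linarith [hc.1, hc.2, hq.1, hq.2]

/-- **Theorem 4 (Policy Loss):** the performance loss incurred by executing the
I-POMDP Lite policy (greedy w.r.t. the Q-values computed from the predicted
strategy `Ppred`), evaluated under the true strategy `Pstar`, is linearly bounded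
by the prediction error `ε_p`:
`sup_b |V*_n(b) − J_n(b)| ≤ 2 ε_p |V| R_max [φ^{n−1} + (1/(1−φ))(1 + 3φ|O|/(1−φ))]`. -/
theorem ipomdp_lite_policy_loss
    [Fintype S] [Fintype U] [Fintype V] [Fintype O]
    [Nonempty S] [Nonempty U] [Nonempty V] [Nonempty O]
    (T : S → U → V → S → ℝ) (Z : S → U → O → ℝ) (R : S → U → V → ℝ)
    (Pstar Ppred : S → V → ℝ) (φ : ℝ) (Rmax : ℝ)
    (hT0 : ∀ s u v s', 0 ≤ T s u v s') (hT1 : ∀ s u v, ∑ s', T s u v s' = 1)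
    (hZ0 : ∀ s' u o, 0 ≤ Z s' u o) (hZ1 : ∀ s' u, ∑ o, Z s' u o = 1)
    (hR : ∀ s u v, 0 ≤ R s u v ∧ R s u v ≤ Rmax)
    (hφ0 : 0 < φ) (hφ1 : φ < 1)
    (hPstar : IsStrategy Pstar) (hPpred : IsStrategy Ppred)
    (n : ℕ) (hn : 1 ≤ n)
    (π : ℕ → (S → ℝ) → U)
    (hπ : ∀ k, 1 ≤ k → k ≤ n → ∀ b : S → ℝ, IsBelief b →
      ∀ u : U, qFun T Z R Ppred φ (k - 1) b u ≤ qFun T Z R Ppred φ (k - 1) b (π k b)) :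
    ∀ b : S → ℝ, IsBelief b →
      |valFun T Z R Pstar φ n b - execJ T Z R Pstar φ π n b| ≤
        2 * predErr Pstar Ppred * (Fintype.card V) * Rmax *
          (φ ^ (n - 1) + (1 / (1 - φ)) * (1 + 3 * φ * (Fintype.card O) / (1 - φ))) := by
  have h1 : 0 < 1 - φ := sub_pos.mpr hφ1
  have hRmax : 0 ≤ Rmax := by
    obtain ⟨h0, h2⟩ := hR (Classical.arbitrary S) (Classical.arbitrary U) (Classical.arbitrary V)
    exact h0.trans h2
  have hε : 0 ≤ predErr Pstar Ppred :=
    (abs_nonneg _).trans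
      (abs_sub_le_predErr Pstar Ppred (Classical.arbitrary S) (Classical.arbitrary V))
  set A : ℝ := predErr Pstar Ppred * Fintype.card V * Rmax with hA
  have hA0 : 0 ≤ A := mul_nonneg (mul_nonneg hε (Nat.cast_nonneg _)) hRmax
  have hδ0 : 0 ≤ A / (1 - φ) / (1 - φ) := div_nonneg (div_nonneg hA0 h1.le) h1.le
  have hstep := fun (k : ℕ) (b : S → ℝ) (hb : IsBelief b) (u : U) =>
    abs_backup_sub_qFun_le hT0 hT1 hZ0 hZ1 hR hRmax hφ0 hφ1 hPstar hPpred k hb u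
  have hV : ∀ k b, IsBelief b →
      |valFun T Z R Pstar φ k b - valFun T Z R Ppred φ k b| ≤ A / (1 - φ) / (1 - φ) := by
    intro k
    induction k with
    | zero => intro b _; simpa [valFun] using hδ0
    | succ k ih =>
      intro b hb
      simp only [valFun]
      exact abs_ciSup_sub_ciSup_le fun u =>
        abs_backup_sub_le_of_backup hT0 hT1 hZ0 hZ1 hφ0 hφ1 hPstar ih hb u (hstep k b hb u)
  have hJ : ∀ k, k ≤ n → ∀ b, IsBelief b →
      |execJ T Z R Pstar φ π k b - valFun T Z R Ppred φ k b| ≤ A / (1 - φ) / (1 - φ) := by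
    intro k
    induction k with
    | zero => intro _ b _; simpa [valFun, execJ] using hδ0
    | succ k ih =>
      intro hk b hb
      have hgreedy : valFun T Z R Ppred φ (k + 1) b = qFun T Z R Ppred φ k b (π (k + 1) b) :=
        le_antisymm (ciSup_le fun u => hπ (k + 1) (Nat.le_add_left 1 k) hk b hb u)
          (le_ciSup (f := qFun T Z R Ppred φ k b) (Set.finite_range _).bddAbove _)
      rw [hgreedy]
      exact abs_backup_sub_le_of_backup hT0 hT1 hZ0 hZ1 hφ0 hφ1 hPstar
        (ih (Nat.le_of_succ_le hk)) hb _ (hstep k b hb _)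
  intro b hb
  have hO : (1 : ℝ) ≤ Fintype.card O := by exact_mod_cast Fintype.card_pos (α := O)
  have hgeom : 1 / (1 - φ) / (1 - φ) = 1 / (1 - φ) * (1 + φ / (1 - φ)) := by
    field_simp
    ring
  have hfactor : 1 / (1 - φ) / (1 - φ) ≤
      φ ^ (n - 1) + 1 / (1 - φ) * (1 + 3 * φ * Fintype.card O / (1 - φ)) := by
    have hφO : φ ≤ 3 * φ * Fintype.card O := by nlinarith
    have hle : 1 / (1 - φ) * (1 + φ / (1 - φ)) ≤
        1 / (1 - φ) * (1 + 3 * φ * Fintype.card O / (1 - φ)) := by gcongr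
    rw [hgeom]
    linarith [pow_nonneg hφ0.le (n - 1)]
  calc |valFun T Z R Pstar φ n b - execJ T Z R Pstar φ π n b|
      ≤ A / (1 - φ) / (1 - φ) + A / (1 - φ) / (1 - φ) := by
        refine (abs_sub_le _ (valFun T Z R Ppred φ n b) _).trans (add_le_add (hV n b hb) ?_)
        rw [abs_sub_comm]
        exact hJ n le_rfl b hb
    _ = 2 * A * (1 / (1 - φ) / (1 - φ)) := by ring
    _ ≤ 2 * A * (φ ^ (n - 1) + 1 / (1 - φ) * (1 + 3 * φ * Fintype.card O / (1 - φ))) :=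
        mul_le_mul_of_nonneg_left hfactor (by positivity)
    _ = _ := by rw [hA]; ring
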